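/- With A, b, σ, β as above, if 0 < τ ≤ min{2, β/‖A⁻¹b‖₁, β/(β - ‖(A-βI)⁻¹b‖₁)}, then h(μ) = τ‖(A-μI)⁻¹b‖₁ + (1-τ)μ is a contraction on [0,β], i.e. |h'(μ)| < 1 for all μ ∈ [0,β]; hence the iteration μ_{k+1} = h(μ_k) converges to the unique fixed point μ* ∈ [0,β] for any starting value μ₀ ∈ [0,β]. -/

import Mathlib

open Matrix Set Filter Topology

/-- ℓ¹ norm of a vector in ℝⁿ. -/
noncomputable def l1 {n : ℕ} (x : Fin n → ℝ) : ℝ := ∑ i, |x i|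

/-- Induced operator 1-norm of a real matrix (maximum column sum). -/
noncomputable def op1 {n : ℕ} (A : Matrix (Fin n) (Fin n) ℝ) : ℝ := ⨆ j, ∑ i, |A i j|

lemma aux_l1_of_nonneg {n : ℕ} {x : Fin n → ℝ} (hx : ∀ i, 0 ≤ x i) : l1 x = ∑ i, x i :=
  Finset.sum_congr rfl fun i _ => abs_of_nonneg (hx i)

lemma aux_col {n : ℕ} (M : Matrix (Fin n) (Fin n) ℝ) (hM : ∀ i j, 0 ≤ M i j) (j : Fin n) :
    ∑ i, M i j ≤ op1 M := by
  have h := le_ciSup (f := fun j => ∑ i, |M i j|) (Set.finite_range _).bddAbove j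
  simpa [op1, abs_of_nonneg (hM _ _)] using h

lemma aux_sum_mulVec {n : ℕ} (M : Matrix (Fin n) (Fin n) ℝ) (y : Fin n → ℝ) :
    ∑ i, (M *ᵥ y) i = ∑ j, (∑ i, M i j) * y j := by
  simp only [Matrix.mulVec, dotProduct, Finset.sum_mul]
  exact Finset.sum_comm

lemma aux_sum_le {n : ℕ} (M : Matrix (Fin n) (Fin n) ℝ) (hM : ∀ i j, 0 ≤ M i j)
    (y : Fin n → ℝ) (hy : ∀ i, 0 ≤ y i) :
    ∑ i, (M *ᵥ y) i ≤ op1 M * ∑ i, y i := by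
  rw [aux_sum_mulVec, Finset.mul_sum]
  exact Finset.sum_le_sum fun j _ => mul_le_mul_of_nonneg_right (aux_col M hM j) (hy j)

lemma aux_nonneg {n : ℕ} (M : Matrix (Fin n) (Fin n) ℝ) (hM : ∀ i j, 0 ≤ M i j)
    (c : ℝ) (hc : op1 M < c) (hc0 : 0 < c) (y : Fin n → ℝ)
    (h : ∀ i, 0 ≤ c * y i - (M *ᵥ y) i) (i : Fin n) : 0 ≤ y i := by
  set z : Fin n → ℝ := fun i => max (-y i) 0 with hz
  have hz0 : ∀ i, 0 ≤ z i := fun i => le_max_right _ _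
  have hzy : ∀ i, -y i ≤ z i := fun i => le_max_left _ _
  have hMz : ∀ i, 0 ≤ (M *ᵥ z) i := fun i =>
    show 0 ≤ ∑ j, M i j * z j from Finset.sum_nonneg fun j _ => mul_nonneg (hM i j) (hz0 j)
  have hMy : ∀ i, -(M *ᵥ y) i ≤ (M *ᵥ z) i := by
    intro i
    simp only [Matrix.mulVec, dotProduct, ← Finset.sum_neg_distrib]
    exact Finset.sum_le_sum fun j _ => by nlinarith [hM i j, hzy j]
  have h1 : ∀ i, c * z i ≤ (M *ᵥ z) i := by
    intro i
    rcases max_choice (-y i) 0 with h' | h'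
    · have : z i = -y i := h'
      rw [this]; linarith [h i, hMy i]
    · have : z i = 0 := h'
      rw [this]; simpa using hMz i
  have h2 : c * ∑ i, z i ≤ op1 M * ∑ i, z i := by
    refine le_trans ?_ (aux_sum_le M hM z hz0)
    rw [Finset.mul_sum]
    exact Finset.sum_le_sum fun i _ => h1 i
  have h3 : z i ≤ ∑ i, z i := Finset.single_le_sum (fun j _ => hz0 j) (Finset.mem_univ i)
  have h4 : ∑ i, z i ≤ 0 := by
    by_contra hh
    push Not at hh
    nlinarith
  linarith [hzy i]

lemma aux_apply {n : ℕ} (M : Matrix (Fin n) (Fin n) ℝ) (c : ℝ) (y : Fin n → ℝ) (i : Fin n) :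
    ((c • (1 : Matrix (Fin n) (Fin n) ℝ) - M) *ᵥ y) i = c * y i - (M *ᵥ y) i := by
  simp [Matrix.sub_mulVec, Matrix.smul_mulVec]

lemma aux_isUnit {n : ℕ} (M : Matrix (Fin n) (Fin n) ℝ) (hM : ∀ i j, 0 ≤ M i j)
    (c : ℝ) (hc : op1 M < c) (hc0 : 0 < c) :
    IsUnit (c • (1 : Matrix (Fin n) (Fin n) ℝ) - M) := by
  rw [← Matrix.mulVec_injective_iff_isUnit]
  intro x y hxy
  have key : ∀ x y : Fin n → ℝ, (c • (1 : Matrix (Fin n) (Fin n) ℝ) - M) *ᵥ x =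
      (c • (1 : Matrix (Fin n) (Fin n) ℝ) - M) *ᵥ y → ∀ i, 0 ≤ (x - y) i := by
    intro x y hxy
    refine aux_nonneg M hM c hc hc0 _ ?_
    intro i
    rw [← aux_apply, Matrix.mulVec_sub, hxy]
    simp
  funext i
  have h1 := key x y hxy i
  have h2 := key y x hxy.symm i
  simp only [Pi.sub_apply] at h1 h2
  linarith

/-- The main facts on the resolvent family. -/
lemma aux_main {n : ℕ} (M : Matrix (Fin n) (Fin n) ℝ) (hM : ∀ i j, 0 ≤ M i j)
    (c : ℝ) (hc : op1 M < c) (hc0 : 0 < c) (x : Fin n → ℝ) (hx : ∀ i, 0 ≤ x i) :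
    (∀ i, 0 ≤ ((c • (1 : Matrix (Fin n) (Fin n) ℝ) - M)⁻¹ *ᵥ x) i) ∧
    (c - op1 M) * l1 ((c • (1 : Matrix (Fin n) (Fin n) ℝ) - M)⁻¹ *ᵥ x) ≤ l1 x ∧
    l1 x ≤ c * l1 ((c • (1 : Matrix (Fin n) (Fin n) ℝ) - M)⁻¹ *ᵥ x) := by
  have hu := aux_isUnit M hM c hc hc0
  set y := (c • (1 : Matrix (Fin n) (Fin n) ℝ) - M)⁻¹ *ᵥ x with hy
  have hyx : (c • (1 : Matrix (Fin n) (Fin n) ℝ) - M) *ᵥ y = x := by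
    rw [hy, Matrix.mulVec_mulVec, Matrix.mul_nonsing_inv _ ((Matrix.isUnit_iff_isUnit_det _).1 hu),
      Matrix.one_mulVec]
  have hxi : ∀ i, c * y i - (M *ᵥ y) i = x i := fun i => by rw [← aux_apply, hyx]
  have hy0 : ∀ i, 0 ≤ y i :=
    aux_nonneg M hM c hc hc0 y fun i => by rw [hxi]; exact hx i
  have hs : ∑ i, x i = c * ∑ i, y i - ∑ i, (M *ᵥ y) i := by
    rw [Finset.mul_sum, ← Finset.sum_sub_distrib]
    exact Finset.sum_congr rfl fun i _ => (hxi i).symm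
  have hMy : 0 ≤ ∑ i, (M *ᵥ y) i := Finset.sum_nonneg fun i _ =>
    show 0 ≤ ∑ j, M i j * y j from Finset.sum_nonneg fun j _ => mul_nonneg (hM i j) (hy0 j)
  have hle := aux_sum_le M hM y hy0
  rw [aux_l1_of_nonneg hy0, aux_l1_of_nonneg hx]
  exact ⟨hy0, by linarith, by linarith⟩

/-- Abstract scalar part: a self-map of `[0,β]` with Lipschitz constant below one. -/
lemma aux_contract (β K : ℝ) (hβ : 0 ≤ β) (hK0 : 0 ≤ K) (hK : K < 1) (h : ℝ → ℝ)
    (hm : ∀ x ∈ Icc (0 : ℝ) β, h x ∈ Icc (0 : ℝ) β)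
    (hl : ∀ x ∈ Icc (0 : ℝ) β, ∀ y ∈ Icc (0 : ℝ) β, |h x - h y| ≤ K * |x - y|) :
    ∃ p ∈ Icc (0 : ℝ) β, h p = p ∧ (∀ q ∈ Icc (0 : ℝ) β, h q = q → q = p) ∧
      ∀ x ∈ Icc (0 : ℝ) β, Tendsto (fun k => h^[k] x) atTop (𝓝 p) := by
  have hcont : ContinuousOn h (Icc (0 : ℝ) β) := by
    have : LipschitzOnWith ⟨K, hK0⟩ h (Icc (0 : ℝ) β) :=
      LipschitzOnWith.of_dist_le_mul fun x hx y hy => by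
        rw [Real.dist_eq, Real.dist_eq]; exact hl x hx y hy
    exact this.continuousOn
  obtain ⟨p, hp, hfp⟩ : ∃ p ∈ Icc (0 : ℝ) β, h p = p := by
    have hc2 : ContinuousOn (fun x => x - h x) (Icc (0 : ℝ) β) := continuousOn_id.sub hcont
    have h0 := (hm 0 ⟨le_rfl, hβ⟩).1
    have h1 := (hm β ⟨hβ, le_rfl⟩).2
    obtain ⟨p, hp, hpp⟩ := intermediate_value_Icc hβ hc2
      (show (0 : ℝ) ∈ Icc (0 - h 0) (β - h β) from ⟨by linarith, by linarith⟩)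
    exact ⟨p, hp, by simp only at hpp; linarith⟩
  refine ⟨p, hp, hfp, ?_, ?_⟩
  · intro q hq hfq
    have := hl q hq p hp
    rw [hfq, hfp] at this
    have h3 := abs_nonneg (q - p)
    have : |q - p| = 0 := by nlinarith
    linarith [abs_eq_zero.1 this]
  · intro x hx
    have hit : ∀ k, h^[k] x ∈ Icc (0 : ℝ) β ∧ |h^[k] x - p| ≤ K ^ k * |x - p| := by
      intro k
      induction k with
      | zero => simpa using hx
      | succ k ih =>
        rw [Function.iterate_succ_apply']
        refine ⟨hm _ ih.1, ?_⟩
        have := hl _ ih.1 p hp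
        rw [hfp] at this
        calc _ ≤ _ := this
          _ ≤ K * (K ^ k * |x - p|) := mul_le_mul_of_nonneg_left ih.2 hK0
          _ = _ := by ring
    rw [tendsto_iff_dist_tendsto_zero]
    refine squeeze_zero (fun _ => dist_nonneg) (fun k => ?_)
      (g := fun k => K ^ k * |x - p|) ?_
    · rw [Real.dist_eq]; exact (hit k).2
    · simpa using (tendsto_pow_atTop_nhds_zero_of_lt_one hK0 hK).mul_const (|x - p|)

set_option maxHeartbeats 1000000

/-- Lemma 14: for `0 < τ ≤ min{2, β/‖A⁻¹b‖₁, β/(β - ‖(A-βI)⁻¹b‖₁)}`, the map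
`h(μ) = τ‖(A-μI)⁻¹b‖₁ + (1-τ)μ` is a contraction on `[0,β]`
(`|h'(μ)| < 1`, with `h'(μ) = τ(‖(A-μI)⁻²b‖₁ - 1) + 1`), and the iterates
`μ_{k+1} = h(μ_k)` converge to the unique fixed point `μ* ∈ [0,β]` from any
starting value `μ₀ ∈ [0,β]`. -/
theorem stmt_10 {n : ℕ} (M : Matrix (Fin n) (Fin n) ℝ) (hM : ∀ i j, 0 ≤ M i j)
    (σ β : ℝ) (hσ : σ = op1 M) (hσ1 : σ < 1) (hβ : β = 1 - σ)
    (A : Matrix (Fin n) (Fin n) ℝ) (hA : A = (2 - σ) • (1 : Matrix (Fin n) (Fin n) ℝ) - M)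
    (b : Fin n → ℝ) (hb : ∀ i, 0 ≤ b i) (hb1 : l1 b < β ^ 2)
    (τ : ℝ) (hτ0 : 0 < τ)
    (hτ : τ ≤ min 2 (min (β / l1 (A⁻¹.mulVec b))
      (β / (β - l1 ((A - β • 1)⁻¹.mulVec b))))) :
    (∀ μ ∈ Icc (0 : ℝ) β,
      |τ * (l1 (((A - μ • 1)⁻¹ * (A - μ • 1)⁻¹).mulVec b) - 1) + 1| < 1) ∧
    ∃ μs ∈ Icc (0 : ℝ) β,
      (τ * l1 ((A - μs • 1)⁻¹.mulVec b) + (1 - τ) * μs = μs) ∧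
      (∀ μ' ∈ Icc (0 : ℝ) β,
        τ * l1 ((A - μ' • 1)⁻¹.mulVec b) + (1 - τ) * μ' = μ' → μ' = μs) ∧
      (∀ μ₀ ∈ Icc (0 : ℝ) β,
        Tendsto (fun k => (fun μ => τ * l1 ((A - μ • 1)⁻¹.mulVec b) + (1 - τ) * μ)^[k] μ₀)
          atTop (𝓝 μs)) := by
  have hσ0 : 0 ≤ σ := by
    rw [hσ]
    exact Real.iSup_nonneg fun j => Finset.sum_nonneg fun i _ => abs_nonneg _
  have hβ0 : 0 < β := by linarith
  have hAμ : ∀ μ : ℝ, A - μ • (1 : Matrix (Fin n) (Fin n) ℝ) =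
      (1 + β - μ) • (1 : Matrix (Fin n) (Fin n) ℝ) - M := by
    intro μ
    rw [hA, hβ]
    module
  obtain ⟨R, hR⟩ : ∃ R : ℝ → Matrix (Fin n) (Fin n) ℝ,
    R = fun μ => (A - μ • (1 : Matrix (Fin n) (Fin n) ℝ))⁻¹ := ⟨_, rfl⟩
  have hRe : ∀ μ, (A - μ • (1 : Matrix (Fin n) (Fin n) ℝ))⁻¹ = R μ := fun μ => by rw [hR]
  have hA0 : A⁻¹ = R 0 := by rw [← hRe]; simp
  have hu : ∀ μ ≤ β, IsUnit (A - μ • (1 : Matrix (Fin n) (Fin n) ℝ)).det := by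
    intro μ hμ
    rw [← Matrix.isUnit_iff_isUnit_det, hAμ]
    exact aux_isUnit M hM _ (by linarith) (by linarith)
  have hRm : ∀ μ ≤ β, ∀ x : Fin n → ℝ, (∀ i, 0 ≤ x i) →
      (∀ i, 0 ≤ (R μ *ᵥ x) i) ∧ (2 * β - μ) * l1 (R μ *ᵥ x) ≤ l1 x ∧
      l1 x ≤ (1 + β - μ) * l1 (R μ *ᵥ x) := by
    intro μ hμ x hx
    have := aux_main M hM (1 + β - μ) (by linarith) (by linarith) x hx
    rw [← hAμ, hRe, ← hσ, show 1 + β - μ - σ = 2 * β - μ by rw [hβ]; ring] at this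
    exact this
  have hres : ∀ μ ≤ β, ∀ ν ≤ β, R μ - R ν = (μ - ν) • (R μ * R ν) := by
    intro μ hμ ν hν
    have e1 := Matrix.nonsing_inv_mul _ (hu μ hμ)
    have e2 := Matrix.mul_nonsing_inv _ (hu ν hν)
    rw [hRe] at e1 e2
    have : R μ * ((A - ν • (1 : Matrix (Fin n) (Fin n) ℝ)) -
        (A - μ • (1 : Matrix (Fin n) (Fin n) ℝ))) * R ν = R μ - R ν := by
      rw [mul_sub, sub_mul, e1, mul_assoc, e2]; simp
    rw [← this, show (A - ν • (1 : Matrix (Fin n) (Fin n) ℝ)) -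
        (A - μ • (1 : Matrix (Fin n) (Fin n) ℝ)) = (μ - ν) • (1 : Matrix (Fin n) (Fin n) ℝ) by
        module]
    simp
  simp only [hRe, hA0] at hτ ⊢
  -- l1 of R μ x
  have l1nn : ∀ x : Fin n → ℝ, 0 ≤ l1 x := fun x => Finset.sum_nonneg fun i _ => abs_nonneg _
  -- difference formula
  have hdiff : ∀ μ ≤ β, ∀ ν ≤ β, ∀ x : Fin n → ℝ, (∀ i, 0 ≤ x i) →
      l1 (R μ *ᵥ x) - l1 (R ν *ᵥ x) = (μ - ν) * l1 (R μ *ᵥ (R ν *ᵥ x)) := by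
    intro μ hμ ν hν x hx
    have hx1 := (hRm ν hν x hx).1
    rw [aux_l1_of_nonneg (hRm μ hμ x hx).1, aux_l1_of_nonneg hx1,
      aux_l1_of_nonneg (hRm μ hμ _ hx1).1, ← Finset.sum_sub_distrib, Finset.mul_sum]
    refine Finset.sum_congr rfl fun i _ => ?_
    have := congrFun (congrArg (fun B => B *ᵥ x) (hres μ hμ ν hν)) i
    simpa [Matrix.sub_mulVec, Matrix.smul_mulVec, Matrix.mulVec_mulVec] using this
  have hle2 : τ ≤ 2 := hτ.trans (min_le_left _ _)
  have hleA : τ ≤ β / l1 (R 0 *ᵥ b) :=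
    hτ.trans ((min_le_right _ _).trans (min_le_left _ _))
  have hleB : τ ≤ β / (β - l1 (R β *ᵥ b)) :=
    hτ.trans ((min_le_right _ _).trans (min_le_right _ _))
  obtain ⟨g, hg⟩ : ∃ g : ℝ → ℝ, g = fun μ => l1 (R μ *ᵥ b) := ⟨_, rfl⟩
  have hge : ∀ μ, l1 (R μ *ᵥ b) = g μ := fun μ => by rw [hg]
  obtain ⟨s, hs⟩ : ∃ s : ℝ → ℝ → ℝ, s = fun μ ν => l1 (R μ *ᵥ (R ν *ᵥ b)) := ⟨_, rfl⟩
  have hse : ∀ μ ν, l1 (R μ *ᵥ (R ν *ᵥ b)) = s μ ν := fun μ ν => by rw [hs]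
  have hgs : ∀ μ ≤ β, ∀ ν ≤ β, g μ - g ν = (μ - ν) * s μ ν := by
    intro μ hμ ν hν
    rw [← hge, ← hge, ← hse]; exact hdiff μ hμ ν hν b hb
  have hg0 : ∀ μ, 0 ≤ g μ := fun μ => by rw [← hge]; exact l1nn _
  have hs0 : ∀ μ ν, 0 ≤ s μ ν := fun μ ν => by rw [← hse]; exact l1nn _
  have hg1 : ∀ μ ≤ β, (2 * β - μ) * g μ ≤ l1 b ∧ l1 b ≤ (1 + β - μ) * g μ := by
    intro μ hμ
    rw [← hge]; exact (hRm μ hμ b hb).2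
  have hs1 : ∀ μ ≤ β, ∀ ν ≤ β,
      (2 * β - μ) * s μ ν ≤ g ν ∧ g ν ≤ (1 + β - μ) * s μ ν := by
    intro μ hμ ν hν
    rw [← hge, ← hse]; exact (hRm μ hμ _ (hRm ν hν b hb).1).2
  have hmono : ∀ μ ≤ β, s μ 0 ≤ s β μ := by
    intro μ hμ
    -- s β μ - s 0 μ = β * _ ≥ 0 and s 0 μ = s μ 0
    have h1 := hdiff β le_rfl 0 hβ0.le (R μ *ᵥ b) (hRm μ hμ b hb).1
    have h2 : s 0 μ = s μ 0 := by
      rw [← hse, ← hse, Matrix.mulVec_mulVec, Matrix.mulVec_mulVec, ← hRe, ← hRe,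
        ← Matrix.mul_inv_rev, ← Matrix.mul_inv_rev]
      congr 3
      simp only [sub_mul, mul_sub]
      simp
    rw [hse, hse] at h1
    have h3 := mul_nonneg hβ0.le (l1nn (R β *ᵥ (R 0 *ᵥ (R μ *ᵥ b))))
    rw [sub_zero] at h1
    linarith
  simp only [hge] at hleA hleB ⊢
  simp only [← Matrix.mulVec_mulVec, hse]
  have hg0pos : 0 < g 0 := by
    rcases (hg0 0).lt_or_eq with h | h
    · exact h
    · rw [← h, div_zero] at hleA; linarith
  have hbpos : 0 < l1 b := by
    have := (hg1 0 hβ0.le).1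
    nlinarith
  have hA' : τ * g 0 ≤ β := by rwa [le_div_iff₀ hg0pos] at hleA
  have hgβ : g β < β := by
    have := (hg1 β le_rfl).1
    by_contra hh
    push Not at hh
    nlinarith
  have hB' : τ * (β - g β) ≤ β := by rwa [le_div_iff₀ (by linarith)] at hleB
  set q := l1 b / β ^ 2 with hq
  set m := l1 b / (1 + β) ^ 2 with hmdef
  have hq1 : q < 1 := by rw [hq, div_lt_one (by positivity)]; exact hb1
  have hm0 : 0 < m := by positivity
  have hsb : ∀ μ ∈ Icc (0 : ℝ) β, ∀ ν ∈ Icc (0 : ℝ) β, m ≤ s μ ν ∧ s μ ν ≤ q := by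
    intro μ hμ ν hν
    have a1 := hs1 μ hμ.2 ν hν.2
    have a2 := hg1 ν hν.2
    have a3 := hs0 μ ν
    have a4 := hg0 ν
    have b1 : β * s μ ν ≤ g ν := by nlinarith [hμ.2]
    have b2 : β * g ν ≤ l1 b := by nlinarith [hν.2]
    have b3 : g ν ≤ (1 + β) * s μ ν := by nlinarith [hμ.1]
    have b4 : l1 b ≤ (1 + β) * g ν := by nlinarith [hν.1]
    constructor
    · rw [hmdef, div_le_iff₀ (by positivity)]
      have := mul_le_mul_of_nonneg_left b3 (by positivity : 0 ≤ 1 + β)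
      nlinarith
    · rw [hq, le_div_iff₀ (by positivity)]
      have := mul_le_mul_of_nonneg_left b1 hβ0.le
      nlinarith
  obtain ⟨K, hK0, hK1, hK⟩ : ∃ K : ℝ, 0 ≤ K ∧ K < 1 ∧
      ∀ t, m ≤ t → t ≤ q → |τ * (t - 1) + 1| ≤ K := by
    refine ⟨max 0 (max (1 - τ * (1 - q)) (1 - 2 * m)), le_max_left _ _, ?_, ?_⟩
    · refine max_lt one_pos (max_lt ?_ (by linarith))
      have := mul_pos hτ0 (sub_pos.2 hq1)
      linarith
    · intro t h1 h2
      refine le_trans ?_ (le_max_right _ _)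
      rw [abs_le]
      constructor
      · have := le_max_right (1 - τ * (1 - q)) (1 - 2 * m)
        nlinarith
      · refine le_trans ?_ (le_max_left _ _)
        nlinarith
  refine ⟨fun μ hμ => (hK _ (hsb μ hμ μ hμ).1 (hsb μ hμ μ hμ).2).trans_lt hK1, ?_⟩
  refine aux_contract β K hβ0.le hK0 hK1 (fun μ => τ * g μ + (1 - τ) * μ) ?_ ?_
  · intro μ hμ
    have d1 := hgs β le_rfl μ hμ.2
    have d2 := hgs μ hμ.2 0 hβ0.le
    have d3 := (hs1 β le_rfl μ hμ.2).1
    have d4 := hmono μ hμ.2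
    obtain ⟨hμ0, hμβ⟩ := hμ
    have hconv : β * g μ ≤ (β - μ) * g 0 + μ * g β := by
      have := mul_le_mul_of_nonneg_left d4 (mul_nonneg hμ0 (sub_nonneg.2 hμβ))
      have e1 : g β = g μ + (β - μ) * s β μ := by linarith
      have e2 : g 0 = g μ - μ * s μ 0 := by linarith
      rw [e1, e2]
      linarith
    have hlow : β * g β ≤ (2 * β - μ) * g μ := by
      have e1 : g β = g μ + (β - μ) * s β μ := by linarith
      rw [e1]
      have := mul_le_mul_of_nonneg_left d3 (sub_nonneg.2 hμβ)
      linarith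
    constructor
    · show 0 ≤ τ * g μ + (1 - τ) * μ
      rcases le_total τ 1 with h1 | h1
      · have := mul_nonneg hτ0.le (hg0 μ)
        have := mul_nonneg (sub_nonneg.2 h1) hμ0
        linarith
      · have f1 : (τ - 1) * β ≤ τ * g β := by linarith
        have f2 : β * ((τ - 1) * β) ≤ τ * ((2 * β - μ) * g μ) := by
          have := mul_le_mul_of_nonneg_left f1 hβ0.le
          have := mul_le_mul_of_nonneg_left hlow hτ0.le
          linarith
        have f3 : (τ - 1) * (μ * (2 * β - μ)) ≤ (τ - 1) * β ^ 2 :=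
          mul_le_mul_of_nonneg_left (by linarith [sq_nonneg (β - μ)]) (by linarith)
        have f4 : 0 ≤ (2 * β - μ) * (τ * g μ + (1 - τ) * μ) := by linarith
        exact nonneg_of_mul_nonneg_right f4 (by linarith)
    · show τ * g μ + (1 - τ) * μ ≤ β
      have f1 : τ * g β + (1 - τ) * β ≤ β := by
        have := mul_nonneg hτ0.le (sub_nonneg.2 hgβ.le)
        linarith
      have f2 := mul_le_mul_of_nonneg_left hconv hτ0.le
      have f3 := mul_le_mul_of_nonneg_left f1 hμ0
      have f4 := mul_le_mul_of_nonneg_left hA' (sub_nonneg.2 hμβ)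
      have f5 : β * (τ * g μ + (1 - τ) * μ) ≤ β * β := by linarith
      exact le_of_mul_le_mul_left f5 hβ0
  · intro x hx y hy
    have d := hgs x hx.2 y hy.2
    have : (τ * g x + (1 - τ) * x) - (τ * g y + (1 - τ) * y) =
        (τ * (s x y - 1) + 1) * (x - y) := by
      linear_combination τ * d
    show |(τ * g x + (1 - τ) * x) - (τ * g y + (1 - τ) * y)| ≤ K * |x - y|
    rw [this, abs_mul]
    exact mul_le_mul_of_nonneg_right (hK _ (hsb x hx y hy).1 (hsb x hx y hy).2) (abs_nonneg _)
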